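/- arXiv:2111.06516 — 6 statements merged into one kernel-verified Lean document; each statement's English description precedes it below -/
import Mathlib

section
/- Let X₁ and X₂ be symmetric real n×n matrices, set Ã := A − (B₂B₂ᵀ − B₁B₁ᵀ)X₁E, and suppose X₂ solves the Riccati equation with negative semidefinite quadratic term R(X₁) + ÃᵀX₂E + EᵀX₂Ã − EᵀX₂B₂B₂ᵀX₂E = 0. Then the residual of the updated iterate is R(X₁ + X₂) = EᵀX₂B₁B₁ᵀX₂E. -/
open Matrix

/-- The Riccati operator `R(X) = AᵀXE + EᵀXA − EᵀX(B₂B₂ᵀ − B₁B₁ᵀ)XE + CᵀC`. -/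
noncomputable def Ric {n m₁ m₂ p : ℕ} (A E : Matrix (Fin n) (Fin n) ℝ)
    (B₁ : Matrix (Fin n) (Fin m₁) ℝ) (B₂ : Matrix (Fin n) (Fin m₂) ℝ)
    (C : Matrix (Fin p) (Fin n) ℝ) (X : Matrix (Fin n) (Fin n) ℝ) :
    Matrix (Fin n) (Fin n) ℝ :=
  Aᵀ * X * E + Eᵀ * X * A - Eᵀ * X * (B₂ * B₂ᵀ - B₁ * B₁ᵀ) * X * E + Cᵀ * C

/-- Residual of the updated iterate when `X₂` solves the definite step equation. -/
theorem riccati_update_residual {n m₁ m₂ p : ℕ}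
    (A E : Matrix (Fin n) (Fin n) ℝ) (hE : IsUnit E.det)
    (B₁ : Matrix (Fin n) (Fin m₁) ℝ) (B₂ : Matrix (Fin n) (Fin m₂) ℝ)
    (C : Matrix (Fin p) (Fin n) ℝ)
    (X₁ X₂ : Matrix (Fin n) (Fin n) ℝ) (hX₁ : X₁.IsSymm) (hX₂ : X₂.IsSymm)
    (hsol : Ric A E B₁ B₂ C X₁
      + (A - (B₂ * B₂ᵀ - B₁ * B₁ᵀ) * X₁ * E)ᵀ * X₂ * E
      + Eᵀ * X₂ * (A - (B₂ * B₂ᵀ - B₁ * B₁ᵀ) * X₁ * E)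
      - Eᵀ * X₂ * (B₂ * B₂ᵀ) * X₂ * E = 0) :
    Ric A E B₁ B₂ C (X₁ + X₂) = Eᵀ * X₂ * (B₁ * B₁ᵀ) * X₂ * E := by
  have hT : (A - (B₂ * B₂ᵀ - B₁ * B₁ᵀ) * X₁ * E)ᵀ
      = Aᵀ - Eᵀ * X₁ * (B₂ * B₂ᵀ - B₁ * B₁ᵀ) := by
    simp [transpose_mul, hX₁.eq, mul_assoc]
  rw [hT] at hsol
  rw [← sub_eq_zero, ← hsol]
  unfold Ric
  generalize B₂ * B₂ᵀ = S₂
  generalize B₁ * B₁ᵀ = S₁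
  noncomm_ring
end

section
/- Let Ã, E ∈ ℝ^{n×n} with E invertible, B₂ ∈ ℝ^{n×m₂}, and let Q ∈ ℝ^{n×n} be symmetric positive semidefinite. If W is a symmetric real n×n matrix solving ÃᵀWE + EᵀWÃ − EᵀWB₂B₂ᵀWE + Q = 0 and the closed-loop matrix E⁻¹(Ã − B₂B₂ᵀWE) is stable, then W is positive semidefinite. -/
open Matrix

/-- A real square matrix is stable if all of its eigenvalues (as a complex matrix)
have negative real part. -/
def IsStableMat {n : ℕ} (M : Matrix (Fin n) (Fin n) ℝ) : Prop :=
  ∀ μ ∈ spectrum ℂ (M.map (algebraMap ℝ ℂ)), μ.re < 0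

open Filter Topology

/-- In a complex Banach algebra, the powers of an element whose spectrum lies in the open unit
disc tend to zero. -/
theorem tendsto_pow_atTop_nhds_zero_of_spectrum {A : Type*} [NormedRing A] [NormedAlgebra ℂ A]
    [CompleteSpace A] [Nontrivial A] {a : A} (ha : ∀ z ∈ spectrum ℂ a, ‖z‖ < 1) :
    Tendsto (fun k : ℕ => a ^ k) atTop (𝓝 0) := by
  have hρ : spectralRadius ℂ a < 1 :=
    spectrum.spectralRadius_lt_of_forall_lt a (r := 1) fun z hz => ha z hz
  obtain ⟨r, hρr, hr1⟩ := ENNReal.lt_iff_exists_nnreal_btwn.mp hρ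
  have hr1' : r < 1 := by exact_mod_cast hr1
  have hev := (spectrum.pow_nnnorm_pow_one_div_tendsto_nhds_spectralRadius a).eventually_lt_const
    hρr
  refine squeeze_zero_norm' (a := fun k : ℕ => (r : ℝ) ^ k) ?_
    (tendsto_pow_atTop_nhds_zero_of_lt_one r.2 (by exact_mod_cast hr1'))
  filter_upwards [hev, eventually_gt_atTop 0] with k hk hk0
  rw [one_div, ENNReal.rpow_inv_lt_iff (by exact_mod_cast hk0), ENNReal.rpow_natCast] at hk
  exact_mod_cast hk.le

theorem Complex.norm_lt_one_of_re_cayley_neg {z : ℂ} (hz : z + 1 ≠ 0)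
    (h : ((z - 1) / (z + 1)).re < 0) : ‖z‖ < 1 := by
  have hpos : 0 < Complex.normSq (z + 1) := Complex.normSq_pos.mpr hz
  rw [Complex.div_re, ← add_div, div_lt_iff₀ hpos, zero_mul] at h
  simp only [Complex.sub_re, Complex.add_re, Complex.sub_im, Complex.add_im, Complex.one_re,
    Complex.one_im] at h
  have hsq : ‖z‖ ^ 2 < 1 := by
    rw [← Complex.normSq_eq_norm_sq, Complex.normSq_apply]
    nlinarith
  nlinarith [norm_nonneg z]

/-- If the spectrum of `a` lies in the open left half-plane, the spectrum of its Cayley transform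
`(1 + a) (1 - a)⁻¹` lies in the open unit disc. -/
theorem norm_lt_one_of_mem_spectrum_cayley {A : Type*} [Ring A] [Algebra ℂ A] {a s : A}
    (ha : ∀ z ∈ spectrum ℂ a, z.re < 0) (hs : (1 - a) * s = 1) (hs' : s * (1 - a) = 1)
    {z : ℂ} (hz : z ∈ spectrum ℂ ((1 + a) * s)) : ‖z‖ < 1 := by
  have hsu : IsUnit s := ⟨⟨s, 1 - a, hs', hs⟩, rfl⟩
  have key : algebraMap ℂ A z - (1 + a) * s =
      (algebraMap ℂ A (z - 1) - (z + 1) • a) * s := by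
    have : algebraMap ℂ A z = (z • (1 - a)) * s := by
      rw [smul_mul_assoc, hs, Algebra.algebraMap_eq_smul_one]
    rw [this, ← sub_mul]
    congr 1
    simp only [Algebra.algebraMap_eq_smul_one]
    module
  have hnot : ¬ IsUnit (algebraMap ℂ A (z - 1) - (z + 1) • a) := fun h =>
    hz (by rw [spectrum.mem_resolventSet_iff, key]; exact h.mul hsu)
  by_cases hz1 : z + 1 = 0
  · refine absurd ?_ hnot
    have hz0 : z - 1 ≠ 0 := by
      rw [eq_neg_of_add_eq_zero_left hz1]; norm_num
    rw [hz1, zero_smul, sub_zero]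
    exact (isUnit_iff_ne_zero.mpr hz0).map (algebraMap ℂ A)
  · refine Complex.norm_lt_one_of_re_cayley_neg hz1 (ha _ fun h => hnot ?_)
    have : algebraMap ℂ A (z - 1) - (z + 1) • a =
        algebraMap ℂ A (z + 1) * (algebraMap ℂ A ((z - 1) / (z + 1)) - a) := by
      rw [mul_sub, ← map_mul, mul_div_cancel₀ _ hz1, ← Algebra.smul_def]
    rw [this]
    exact ((isUnit_iff_ne_zero.mpr hz1).map (algebraMap ℂ A)).mul h

section

attribute [local instance] Matrix.linftyOpNormedRing Matrix.linftyOpNormedAlgebra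

/-- The powers of a complex matrix all of whose eigenvalues have modulus less than one tend to
zero. -/
theorem Matrix.tendsto_pow_apply_of_spectrum {n : ℕ} {M : Matrix (Fin n) (Fin n) ℂ}
    (hM : ∀ z ∈ spectrum ℂ M, ‖z‖ < 1) (i j : Fin n) :
    Tendsto (fun k : ℕ => (M ^ k) i j) atTop (𝓝 0) := by
  have : Nonempty (Fin n) := ⟨i⟩
  have h := tendsto_pow_atTop_nhds_zero_of_spectrum hM
  exact (((continuous_apply j).comp (continuous_apply i)).tendsto
    (0 : Matrix (Fin n) (Fin n) ℂ)).comp h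

end

theorem IsStableMat.isUnit_one_sub {n : ℕ} {A : Matrix (Fin n) (Fin n) ℝ} (hA : IsStableMat A) :
    IsUnit (1 - A).det := by
  have h1 : IsUnit (algebraMap ℂ (Matrix (Fin n) (Fin n) ℂ) 1 - A.map (algebraMap ℝ ℂ)) := by
    by_contra h
    have := hA 1 h
    norm_num at this
  have h2 : algebraMap ℂ (Matrix (Fin n) (Fin n) ℂ) 1 - A.map (algebraMap ℝ ℂ) =
      (algebraMap ℝ ℂ).mapMatrix (1 - A) := by
    rw [map_sub, map_one, map_one]; rfl
  rw [h2, Matrix.isUnit_iff_isUnit_det, ← RingHom.map_det, isUnit_iff_ne_zero] at h1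
  exact isUnit_iff_ne_zero.mpr fun h => h1 (by rw [h, map_zero])

theorem IsStableMat.tendsto_cayley_pow {n : ℕ} {A : Matrix (Fin n) (Fin n) ℝ}
    (hA : IsStableMat A) :
    Tendsto (fun k : ℕ => ((1 + A) * (1 - A)⁻¹) ^ k) atTop (𝓝 0) := by
  have hu := hA.isUnit_one_sub
  let φ := (algebraMap ℝ ℂ).mapMatrix (m := Fin n)
  have hspec : ∀ z ∈ spectrum ℂ (φ ((1 + A) * (1 - A)⁻¹)), ‖z‖ < 1 := by
    intro z hz
    rw [map_mul, map_add, map_one] at hz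
    refine norm_lt_one_of_mem_spectrum_cayley (a := φ A) hA ?_ ?_ hz
    · rw [← map_one φ, ← map_sub, ← map_mul, Matrix.mul_nonsing_inv _ hu]
    · rw [← map_one φ, ← map_sub, ← map_mul, Matrix.nonsing_inv_mul _ hu]
  refine tendsto_pi_nhds.mpr fun i => tendsto_pi_nhds.mpr fun j => ?_
  have h := Matrix.tendsto_pow_apply_of_spectrum hspec i j
  simp only [← map_pow] at h
  exact (Complex.continuous_re.tendsto 0).comp h

/-- Lyapunov's theorem: if `A` is stable and `Aᵀ P + P A` is negative semidefinite, then `P` is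
positive semidefinite. -/
theorem IsStableMat.posSemidef_of_lyapunov {n : ℕ} {A P : Matrix (Fin n) (Fin n) ℝ}
    (hA : IsStableMat A) (hP : P.IsSymm) (h : (-(Aᵀ * P + P * A)).PosSemidef) :
    P.PosSemidef := by
  have hu := hA.isUnit_one_sub
  have hlim := hA.tendsto_cayley_pow
  set S := (1 - A)⁻¹
  set C := (1 + A) * S with hC
  have hSinv : (1 - A) * S = 1 := Matrix.mul_nonsing_inv _ hu
  have hSinv' : Sᵀ * (1 - A)ᵀ = 1 := by rw [← Matrix.transpose_mul, hSinv, Matrix.transpose_one]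
  have hstein : (P - Cᵀ * P * C).PosSemidef := by
    have h1 : (1 - A)ᵀ * P * (1 - A) - (1 + A)ᵀ * P * (1 + A) =
        (2 : ℝ) • -(Aᵀ * P + P * A) := by
      simp only [Matrix.transpose_sub, Matrix.transpose_add, Matrix.transpose_one, two_smul]
      noncomm_ring
    have h2 : P - Cᵀ * P * C = Sᵀ * ((2 : ℝ) • -(Aᵀ * P + P * A)) * S := by
      rw [← h1, hC, Matrix.transpose_mul]
      calc _ = (Sᵀ * (1 - A)ᵀ) * P * ((1 - A) * S) - Sᵀ * (1 + A)ᵀ * P * ((1 + A) * S) := by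
            rw [hSinv, hSinv', one_mul, mul_one]
        _ = _ := by simp only [mul_sub, sub_mul, mul_assoc]
    rw [h2]
    have := (h.smul (zero_le_two (α := ℝ))).conjTranspose_mul_mul_same S
    rwa [Matrix.conjTranspose_eq_transpose_of_trivial] at this
  have hpow : ∀ k : ℕ, (P - (C ^ k)ᵀ * P * C ^ k).PosSemidef := by
    intro k
    induction k with
    | zero => simpa using Matrix.PosSemidef.zero
    | succ k ih =>
      have h3 := ih.conjTranspose_mul_mul_same C
      rw [Matrix.conjTranspose_eq_transpose_of_trivial] at h3
      convert hstein.add h3 using 1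
      rw [pow_succ, Matrix.transpose_mul]
      noncomm_ring
  refine Matrix.PosSemidef.of_dotProduct_mulVec_nonneg
    (by rw [Matrix.IsHermitian, Matrix.conjTranspose_eq_transpose_of_trivial]; exact hP)
    fun x => ?_
  have hcont : Continuous fun M : Matrix (Fin n) (Fin n) ℝ =>
      star x ⬝ᵥ ((P - Mᵀ * P * M) *ᵥ x) := by fun_prop
  have hl := (hcont.tendsto 0).comp hlim
  simp only [mul_zero, sub_zero] at hl
  exact ge_of_tendsto' hl fun k => (hpow k).dotProduct_mulVec_nonneg x

/-- A symmetric stabilizing solution of a Riccati equation with negative semidefinite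
quadratic term and positive semidefinite constant term is positive semidefinite. -/
theorem stabilizing_solution_posSemidef {n m₂ : ℕ}
    (Atl E : Matrix (Fin n) (Fin n) ℝ) (hE : IsUnit E.det)
    (B₂ : Matrix (Fin n) (Fin m₂) ℝ)
    (Q : Matrix (Fin n) (Fin n) ℝ) (hQ : Q.PosSemidef)
    (W : Matrix (Fin n) (Fin n) ℝ) (hW : W.IsSymm)
    (hsol : Atlᵀ * W * E + Eᵀ * W * Atl - Eᵀ * W * (B₂ * B₂ᵀ) * W * E + Q = 0)
    (hstab : IsStableMat (E⁻¹ * (Atl - B₂ * B₂ᵀ * W * E))) :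
    W.PosSemidef := by
  have hEu : IsUnit E := (Matrix.isUnit_iff_isUnit_det E).mpr hE
  have hWT : Wᵀ = W := hW
  suffices hP : (Eᵀ * W * E).PosSemidef by
    rw [← hEu.posSemidef_star_left_conjugate_iff, Matrix.star_eq_conjTranspose,
      Matrix.conjTranspose_eq_transpose_of_trivial]
    exact hP
  refine hstab.posSemidef_of_lyapunov ?_ ?_
  · simp only [Matrix.IsSymm, Matrix.transpose_mul, Matrix.transpose_transpose, hWT,
      Matrix.mul_assoc]
  · set G := B₂ * B₂ᵀ with hG
    have hGpsd : G.PosSemidef := by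
      have := Matrix.posSemidef_self_mul_conjTranspose B₂
      rwa [Matrix.conjTranspose_eq_transpose_of_trivial] at this
    have hGT : Gᵀ = G := by rw [hG, Matrix.transpose_mul, Matrix.transpose_transpose]
    set K := Atl - G * W * E with hK
    have h1 : E * (E⁻¹ * K) = K := Matrix.mul_nonsing_inv_cancel_left _ _ hE
    have h2 : (E⁻¹ * K)ᵀ * Eᵀ = Kᵀ := by rw [← Matrix.transpose_mul, h1]
    have h3 : -((E⁻¹ * K)ᵀ * (Eᵀ * W * E) + Eᵀ * W * E * (E⁻¹ * K)) =
        Q + (W * E)ᵀ * G * (W * E) := by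
      have e1 : (E⁻¹ * K)ᵀ * (Eᵀ * W * E) = Kᵀ * W * E := by
        rw [← h2]; simp only [Matrix.mul_assoc]
      have e2 : Eᵀ * W * E * (E⁻¹ * K) = Eᵀ * W * K := by
        rw [Matrix.mul_assoc _ E, h1]
      have e3 : Kᵀ = Atlᵀ - Eᵀ * W * G := by
        rw [hK]
        simp only [Matrix.transpose_sub, Matrix.transpose_mul, hWT, hGT, Matrix.mul_assoc]
      rw [e1, e2, e3, hK, Matrix.transpose_mul, hWT, ← sub_eq_zero, ← neg_eq_zero, ← hsol]
      noncomm_ring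
    rw [h3]
    have h4 := hGpsd.conjTranspose_mul_mul_same (W * E)
    rw [Matrix.conjTranspose_eq_transpose_of_trivial] at h4
    exact hQ.add h4
end

section
/- Let (X_k)_{k≥0}, (W_k)_{k≥1} be a Riccati iteration sequence. Then for every k ≥ 0 the residual of the iterate X_{k+1} satisfies R(X_{k+1}) = EᵀW_{k+1}B₁B₁ᵀW_{k+1}E; in particular, every residual R(X_{k+1}) is symmetric positive semidefinite. -/
open Matrix

/-- A Riccati iteration sequence: symmetric matrices `X k` (k ≥ 0) and `W k` (k ≥ 1)
with `X 0 = 0`, `X (k+1) = X k + W (k+1)`, and `W (k+1)` solving the step Riccati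
equation with coefficient `A_k = A + (B₁B₁ᵀ − B₂B₂ᵀ)X_kE`. -/
noncomputable def RiccatiIter {n m₁ m₂ p : ℕ} (A E : Matrix (Fin n) (Fin n) ℝ)
    (B₁ : Matrix (Fin n) (Fin m₁) ℝ) (B₂ : Matrix (Fin n) (Fin m₂) ℝ)
    (C : Matrix (Fin p) (Fin n) ℝ)
    (X W : ℕ → Matrix (Fin n) (Fin n) ℝ) : Prop :=
  X 0 = 0 ∧ (∀ k, (X k).IsSymm) ∧ (∀ k, (W (k + 1)).IsSymm) ∧
  (∀ k, X (k + 1) = X k + W (k + 1)) ∧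
  (∀ k, (A + (B₁ * B₁ᵀ - B₂ * B₂ᵀ) * X k * E)ᵀ * W (k + 1) * E
      + Eᵀ * W (k + 1) * (A + (B₁ * B₁ᵀ - B₂ * B₂ᵀ) * X k * E)
      - Eᵀ * W (k + 1) * (B₂ * B₂ᵀ) * W (k + 1) * E
      + Ric A E B₁ B₂ C (X k) = 0)

/-- The residual of every iterate `X (k+1)` equals `EᵀW_{k+1}B₁B₁ᵀW_{k+1}E`, and is in
particular symmetric positive semidefinite. -/
theorem riccati_iteration_residual {n m₁ m₂ p : ℕ}
    (A E : Matrix (Fin n) (Fin n) ℝ) (hE : IsUnit E.det)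
    (B₁ : Matrix (Fin n) (Fin m₁) ℝ) (B₂ : Matrix (Fin n) (Fin m₂) ℝ)
    (C : Matrix (Fin p) (Fin n) ℝ)
    (X W : ℕ → Matrix (Fin n) (Fin n) ℝ)
    (hiter : RiccatiIter A E B₁ B₂ C X W) :
    ∀ k : ℕ, Ric A E B₁ B₂ C (X (k + 1)) = Eᵀ * W (k + 1) * (B₁ * B₁ᵀ) * W (k + 1) * E
      ∧ (Ric A E B₁ B₂ C (X (k + 1))).PosSemidef := by
  intro k
  obtain ⟨-, hX, hW, hstep, heq⟩ := hiter
  have key : Ric A E B₁ B₂ C (X (k + 1))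
      = Eᵀ * W (k + 1) * (B₁ * B₁ᵀ) * W (k + 1) * E := by
    rw [← sub_eq_zero, ← heq k, hstep k]
    simp only [Ric, transpose_add, transpose_sub, transpose_mul, transpose_transpose, (hX k).eq]
    noncomm_ring
  refine ⟨key, ?_⟩
  have gram : Eᵀ * W (k + 1) * (B₁ * B₁ᵀ) * W (k + 1) * E
      = (B₁ᵀ * W (k + 1) * E)ᴴ * (B₁ᵀ * W (k + 1) * E) := by
    simp only [conjTranspose_eq_transpose_of_trivial, transpose_mul, transpose_transpose,
      (hW k).eq, Matrix.mul_assoc]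
  rw [key, gram]
  exact posSemidef_conjTranspose_mul_self _
end

section
/- Assume (A, B₂, E) is stabilizable, (A, C, E) has no unobservable purely imaginary modes, and there exists a stabilizing solution X∞ of the indefinite Riccati equation R(X) = 0. Let (X_k)_{k≥0}, (W_k)_{k≥1} be a Riccati iteration sequence in which every W_{k+1} is a stabilizing solution of its step Riccati equation. Then the iterates are bounded above by X∞ in the Loewner order: X_k ≤ X∞ for all k ≥ 0. -/
open Matrix

section

open scoped ComplexOrder
open Filter Topology

/-- In a complex Banach algebra, the powers of an element of spectral radius less than one
tend to zero. -/
theorem tendsto_pow_zero_of_spectralRadius_lt_one {R : Type*} [NormedRing R] [NormedAlgebra ℂ R]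
    [CompleteSpace R] (a : R) (h : spectralRadius ℂ a < 1) :
    Tendsto (fun k : ℕ => a ^ k) atTop (𝓝 0) := by
  obtain ⟨r, hr, hr1⟩ := ENNReal.lt_iff_exists_nnreal_btwn.1 h
  have hev := (spectrum.pow_nnnorm_pow_one_div_tendsto_nhds_spectralRadius a).eventually
    (gt_mem_nhds hr)
  have hr1' : (r : ℝ) < 1 := by exact_mod_cast hr1
  refine squeeze_zero_norm' (a := fun k : ℕ => (r : ℝ) ^ k) ?_
    (tendsto_pow_atTop_nhds_zero_of_lt_one r.2 hr1')
  filter_upwards [hev, eventually_gt_atTop 0] with k hk hk0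
  have hk' : (0 : ℝ) < k := by exact_mod_cast hk0
  have h2 := ENNReal.rpow_le_rpow hk.le hk'.le
  rw [← ENNReal.rpow_mul, one_div, inv_mul_cancel₀ hk'.ne', ENNReal.rpow_one,
    ENNReal.rpow_natCast] at h2
  exact_mod_cast h2

namespace Matrix

variable {ι κ : Type*} [Fintype ι] [DecidableEq ι] [Fintype κ]

theorem mem_spectrum_iff_exists_mulVec_eq {K : Type*} [Field K] {M : Matrix ι ι K} {μ : K} :
    μ ∈ spectrum K M ↔ ∃ v, v ≠ 0 ∧ M *ᵥ v = μ • v := by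
  rw [← spectrum_toLin', ← Module.End.hasEigenvalue_iff_mem_spectrum]
  constructor
  · intro h
    obtain ⟨v, hv⟩ := h.exists_hasEigenvector
    exact ⟨v, hv.2, by simpa using hv.apply_eq_smul⟩
  · rintro ⟨v, hv0, hv⟩
    exact Module.End.hasEigenvalue_of_hasEigenvector (x := v)
      (Module.End.hasEigenvector_iff.2 ⟨Module.End.mem_eigenspace_iff.2 (by simpa using hv), hv0⟩)

/-- The powers of a complex matrix with spectrum in the open unit disc tend to zero. -/
theorem tendsto_pow_zero_of_spectrum_norm_lt_one (M : Matrix ι ι ℂ)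
    (h : ∀ μ ∈ spectrum ℂ M, ‖μ‖ < 1) : Tendsto (fun k : ℕ => M ^ k) atTop (𝓝 0) := by
  cases isEmpty_or_nonempty ι
  · exact tendsto_const_nhds.congr fun k => Subsingleton.elim (0 : Matrix ι ι ℂ) (M ^ k)
  let : NormedRing (Matrix ι ι ℂ) := Matrix.linftyOpNormedRing
  let : NormedAlgebra ℂ (Matrix ι ι ℂ) := Matrix.linftyOpNormedAlgebra
  refine tendsto_pow_zero_of_spectralRadius_lt_one M ?_
  exact spectrum.spectralRadius_lt_of_forall_lt M (r := 1) fun μ hμ => by exact_mod_cast h μ hμ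

/-- Lyapunov's theorem: if `M` is stable, `D` is Hermitian and `Mᴴ D + D M ≤ 0`, then `D ≥ 0`. -/
theorem posSemidef_of_lyapunov {M D : Matrix ι ι ℂ} (hM : ∀ μ ∈ spectrum ℂ M, μ.re < 0)
    (hD : D.IsHermitian) (hQ : (-(Mᴴ * D + D * M)).PosSemidef) : D.PosSemidef := by
  have hu : IsUnit (1 - M) := by
    by_contra hu
    have : (1 : ℂ) ∈ spectrum ℂ M := by
      rw [spectrum.mem_iff]
      simpa using hu
    have := hM _ this
    norm_num at this
  obtain ⟨u, hu⟩ := hu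
  set N : Matrix ι ι ℂ := ↑u⁻¹
  have hN : (1 - M) * N = 1 := by rw [← hu]; exact u.mul_inv
  have hN' : N * (1 - M) = 1 := by rw [← hu]; exact u.inv_mul
  set Φ := (1 + M) * N with hΦ
  have hspec : ∀ ν ∈ spectrum ℂ Φ, ‖ν‖ < 1 := by
    intro ν hν
    obtain ⟨v, hv0, hv⟩ := mem_spectrum_iff_exists_mulVec_eq.1 hν
    obtain ⟨w, rfl⟩ : ∃ w, v = (1 - M) *ᵥ w := ⟨N *ᵥ v, by rw [mulVec_mulVec, hN, one_mulVec]⟩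
    rw [hΦ, mulVec_mulVec, mul_assoc, hN', mul_one, add_mulVec, sub_mulVec, one_mulVec] at hv
    have hw0 : w ≠ 0 := by
      rintro rfl
      simp at hv0
    have h1 : (ν + 1) • (M *ᵥ w) = (ν - 1) • w := by
      rw [add_smul, sub_smul, one_smul, one_smul, ← sub_eq_zero]
      rw [smul_sub, ← sub_eq_zero] at hv
      rw [← hv]
      abel
    have hν1 : ν + 1 ≠ 0 := by
      intro h0
      rw [h0, zero_smul] at h1
      have h2 : ν - 1 = 0 := (smul_eq_zero.1 h1.symm).resolve_right hw0
      have h3 : (2 : ℂ) = (ν + 1) - (ν - 1) := by ring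
      rw [h0, h2] at h3
      norm_num at h3
    have hμ : (ν - 1) / (ν + 1) ∈ spectrum ℂ M := by
      refine mem_spectrum_iff_exists_mulVec_eq.2 ⟨w, hw0, ?_⟩
      rw [div_eq_inv_mul, mul_smul, ← h1, smul_smul, inv_mul_cancel₀ hν1, one_smul]
    have hre := hM _ hμ
    have hpos : 0 < Complex.normSq (ν + 1) := Complex.normSq_pos.2 hν1
    rw [Complex.div_re, ← add_div, div_lt_iff₀ hpos, zero_mul] at hre
    simp only [Complex.sub_re, Complex.add_re, Complex.sub_im, Complex.add_im, Complex.one_re,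
      Complex.one_im] at hre
    have : ‖ν‖ ^ 2 < 1 := by
      rw [← Complex.normSq_eq_norm_sq, Complex.normSq_apply]
      nlinarith
    exact (sq_lt_one_iff₀ (norm_nonneg _)).1 this
  have hlim := tendsto_pow_zero_of_spectrum_norm_lt_one Φ hspec
  have hstep : (D - Φᴴ * D * Φ).PosSemidef := by
    have h1 := (hQ.add hQ).conjTranspose_mul_mul_same N
    convert h1 using 1
    have hDN : D = Nᴴ * ((1 - M)ᴴ * D * (1 - M)) * N := by
      calc D = ((1 - M) * N)ᴴ * D * ((1 - M) * N) := by simp [hN]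
        _ = _ := by simp only [conjTranspose_mul, mul_assoc]
    have hΦN : Φᴴ * D * Φ = Nᴴ * ((1 + M)ᴴ * D * (1 + M)) * N := by
      simp only [hΦ, conjTranspose_mul, mul_assoc]
    rw [hΦN]
    nth_rewrite 1 [hDN]
    rw [← sub_mul, ← mul_sub]
    congr 2
    simp only [conjTranspose_sub, conjTranspose_add, conjTranspose_one]
    noncomm_ring
  have hpow : ∀ k : ℕ, (D - (Φ ^ k)ᴴ * D * Φ ^ k).PosSemidef := by
    intro k
    induction k with
    | zero => simpa using PosSemidef.zero
    | succ k ih =>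
      convert (ih.conjTranspose_mul_mul_same Φ).add hstep using 1
      rw [pow_succ, conjTranspose_mul]
      noncomm_ring
  refine .of_dotProduct_mulVec_nonneg hD fun x => ?_
  have hcont : Continuous fun P : Matrix ι ι ℂ => star x ⬝ᵥ ((D - Pᴴ * D * P) *ᵥ x) := by
    fun_prop
  have ht := (hcont.tendsto 0).comp hlim
  simp only [conjTranspose_zero, zero_mul, sub_zero] at ht
  exact ge_of_tendsto' ht fun k => (hpow k).dotProduct_mulVec_nonneg x

/-- If `D ≥ 0`, `Lᴴ D + D L + Hᴴ H ≤ 0` and `L + G H` is stable, then `L` is stable. -/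
theorem spectrum_re_neg_of_lyapunov {L D : Matrix ι ι ℂ} {G : Matrix ι κ ℂ} {H : Matrix κ ι ℂ}
    (hD : D.PosSemidef) (hQ : (-(Lᴴ * D + D * L + Hᴴ * H)).PosSemidef)
    (hGH : ∀ μ ∈ spectrum ℂ (L + G * H), μ.re < 0) : ∀ μ ∈ spectrum ℂ L, μ.re < 0 := by
  intro μ hμ
  by_contra! hre
  obtain ⟨v, hv0, hv⟩ := mem_spectrum_iff_exists_mulVec_eq.1 hμ
  have h1 := hQ.dotProduct_mulVec_nonneg v
  have h2 := hD.dotProduct_mulVec_nonneg v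
  set d := star v ⬝ᵥ (D *ᵥ v)
  have e1 : star v ⬝ᵥ ((Lᴴ * D) *ᵥ v) = star μ * d := by
    rw [← mulVec_mulVec, dotProduct_mulVec, ← star_mulVec, hv, star_smul, smul_dotProduct,
      smul_eq_mul]
  have e2 : star v ⬝ᵥ ((D * L) *ᵥ v) = μ * d := by
    rw [← mulVec_mulVec, hv, mulVec_smul, dotProduct_smul, smul_eq_mul]
  have e3 : star v ⬝ᵥ ((Hᴴ * H) *ᵥ v) = star (H *ᵥ v) ⬝ᵥ (H *ᵥ v) := by
    rw [← mulVec_mulVec, dotProduct_mulVec, ← star_mulVec]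
  have hH : H *ᵥ v = 0 := by
    rw [← dotProduct_star_self_eq_zero]
    refine le_antisymm ?_ (dotProduct_star_self_nonneg (H *ᵥ v))
    rw [neg_mulVec, add_mulVec, add_mulVec, dotProduct_neg, dotProduct_add, dotProduct_add,
      e1, e2, e3, ← add_mul] at h1
    have h3 : 0 ≤ (star μ + μ) * d := by
      refine mul_nonneg ?_ h2
      rw [Complex.le_def]
      simp
      linarith
    rw [neg_nonneg] at h1
    exact (le_add_of_nonneg_left h3).trans h1
  refine (hGH μ ?_).not_ge hre
  refine mem_spectrum_iff_exists_mulVec_eq.2 ⟨v, hv0, ?_⟩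
  rw [add_mulVec, ← mulVec_mulVec, hH, mulVec_zero, add_zero, hv]

theorem conjTranspose_map_algebraMap {m n : Type*} (M : Matrix m n ℝ) :
    (M.map (algebraMap ℝ ℂ))ᴴ = Mᵀ.map (algebraMap ℝ ℂ) := by
  ext i j
  simp

open scoped MatrixOrder in
theorem posSemidef_map_algebraMap_iff {D : Matrix ι ι ℝ} :
    (D.map (algebraMap ℝ ℂ)).PosSemidef ↔ D.PosSemidef := by
  constructor
  · intro h
    refine .of_dotProduct_mulVec_nonneg ?_ fun x => ?_
    · have := h.1
      ext i j
      simpa using congrFun (congrFun this i) j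
    · have h1 := h.dotProduct_mulVec_nonneg (algebraMap ℝ ℂ ∘ x)
      have h2 : star (algebraMap ℝ ℂ ∘ x) ⬝ᵥ (D.map (algebraMap ℝ ℂ) *ᵥ (algebraMap ℝ ℂ ∘ x))
          = ((star x ⬝ᵥ (D *ᵥ x) : ℝ) : ℂ) := by
        simp [dotProduct, mulVec]
      rw [h2] at h1
      exact_mod_cast h1
  · intro h
    obtain ⟨B, rfl⟩ := CStarAlgebra.nonneg_iff_eq_star_mul_self.1 h.nonneg
    rw [star_eq_conjTranspose, Matrix.map_mul, conjTranspose_eq_transpose_of_trivial, ← conjTranspose_map_algebraMap]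
    exact posSemidef_conjTranspose_mul_self _

theorem posSemidef_of_lyapunov_real {n : ℕ} {M D : Matrix (Fin n) (Fin n) ℝ} (hM : IsStableMat M)
    (hD : D.IsSymm) (hQ : (-(Mᵀ * D + D * M)).PosSemidef) : D.PosSemidef := by
  rw [← posSemidef_map_algebraMap_iff] at hQ ⊢
  refine posSemidef_of_lyapunov hM ?_ ?_
  · rw [IsHermitian, conjTranspose_map_algebraMap, hD.eq]
  · convert hQ using 1
    rw [conjTranspose_map_algebraMap, ← Matrix.map_mul, ← Matrix.map_mul,
      ← Matrix.map_add _ (map_add _), ← Matrix.map_neg _ (map_neg _)]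

theorem isStableMat_of_lyapunov {n m : ℕ} {L D : Matrix (Fin n) (Fin n) ℝ}
    {G : Matrix (Fin n) (Fin m) ℝ} {H : Matrix (Fin m) (Fin n) ℝ} (hD : D.PosSemidef)
    (hQ : (-(Lᵀ * D + D * L + Hᵀ * H)).PosSemidef) (hGH : IsStableMat (L + G * H)) :
    IsStableMat L := by
  rw [← posSemidef_map_algebraMap_iff] at hD hQ
  refine spectrum_re_neg_of_lyapunov (G := G.map (algebraMap ℝ ℂ)) (H := H.map (algebraMap ℝ ℂ))
    hD ?_ ?_
  · convert hQ using 1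
    rw [conjTranspose_map_algebraMap, conjTranspose_map_algebraMap, ← Matrix.map_mul,
      ← Matrix.map_mul, ← Matrix.map_mul, ← Matrix.map_add _ (map_add _),
      ← Matrix.map_add _ (map_add _), ← Matrix.map_neg _ (map_neg _)]
  · rwa [← Matrix.map_mul, ← Matrix.map_add _ (map_add _)]

theorem PosSemidef.symm_conj {ι κ : Type*} [Fintype ι] [Fintype κ] {Q : Matrix ι ι ℝ}
    (hQ : Q.PosSemidef) {V : Matrix ι ι ℝ} (hV : V.IsSymm) (F : Matrix ι κ ℝ) :
    (Fᵀ * V * Q * V * F).PosSemidef := by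
  have h := hQ.conjTranspose_mul_mul_same (V * F)
  rw [conjTranspose_eq_transpose_of_trivial, transpose_mul, hV.eq] at h
  simpa only [Matrix.mul_assoc] using h

theorem posSemidef_mul_transpose_self {ι κ : Type*} [Fintype ι] [Fintype κ] (B : Matrix ι κ ℝ) :
    (B * Bᵀ).PosSemidef := by
  simpa only [conjTranspose_eq_transpose_of_trivial] using posSemidef_self_mul_conjTranspose B

end Matrix

end

section

variable {n m₁ m₂ p : ℕ} {A E : Matrix (Fin n) (Fin n) ℝ}
  {B₁ : Matrix (Fin n) (Fin m₁) ℝ} {B₂ : Matrix (Fin n) (Fin m₂) ℝ}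
  {C : Matrix (Fin p) (Fin n) ℝ} {X Y V : Matrix (Fin n) (Fin n) ℝ}

/-- A step of the Riccati iteration produces the residual `EᵀV B₁B₁ᵀ V E`. -/
theorem Ric_add_of_step
    (hV : (A + (B₁ * B₁ᵀ - B₂ * B₂ᵀ) * X * E)ᵀ * V * E
      + Eᵀ * V * (A + (B₁ * B₁ᵀ - B₂ * B₂ᵀ) * X * E)
      - Eᵀ * V * (B₂ * B₂ᵀ) * V * E + Ric A E B₁ B₂ C X = 0) (hX : X.IsSymm) :
    Ric A E B₁ B₂ C (X + V) = Eᵀ * V * (B₁ * B₁ᵀ) * V * E := by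
  rw [← sub_eq_zero, ← hV]
  simp only [Ric, transpose_add, transpose_sub, transpose_mul, transpose_transpose, hX.eq]
  noncomm_ring

/-- If `X ≤ Y` with `Ric X ≥ 0` and `Y` is a stabilizing solution of the Riccati equation, then the
closed-loop matrix with the disturbance feedback from `X` and the control feedback from `Y` is
stable. -/
theorem isStableMat_mixed_feedback (hE : IsUnit E.det) (hX : X.IsSymm) (hY : Y.IsSymm)
    (hXY : (Y - X).PosSemidef) (hRX : (Ric A E B₁ B₂ C X).PosSemidef)
    (hRY : Ric A E B₁ B₂ C Y = 0)
    (hstab : IsStableMat (E⁻¹ * (A + (B₁ * B₁ᵀ - B₂ * B₂ᵀ) * Y * E))) :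
    IsStableMat (E⁻¹ * (A + (B₁ * B₁ᵀ * X - B₂ * B₂ᵀ * Y) * E)) := by
  set F := A + (B₁ * B₁ᵀ * X - B₂ * B₂ᵀ * Y) * E with hF
  refine isStableMat_of_lyapunov (D := Eᵀ * (Y - X) * E) (G := E⁻¹ * B₁)
    (H := B₁ᵀ * (Y - X) * E) ?_ ?_ ?_
  · simpa using hXY.conjTranspose_mul_mul_same E
  · have hsum := hRX.add ((posSemidef_mul_transpose_self B₂).symm_conj (hY.sub hX) E)
    convert hsum using 1
    have h1 : (E⁻¹ * F)ᵀ * (Eᵀ * (Y - X) * E) = Fᵀ * (Y - X) * E := by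
      calc _ = (E * (E⁻¹ * F))ᵀ * (Y - X) * E := by
            rw [transpose_mul E]
            simp only [mul_assoc]
        _ = _ := by rw [mul_nonsing_inv_cancel_left _ _ hE]
    have h2 : Eᵀ * (Y - X) * E * (E⁻¹ * F) = Eᵀ * (Y - X) * F := by
      rw [mul_assoc _ E, mul_nonsing_inv_cancel_left _ _ hE]
    have h3 : (B₁ᵀ * (Y - X) * E)ᵀ * (B₁ᵀ * (Y - X) * E)
        = Eᵀ * (Y - X) * (B₁ * B₁ᵀ) * (Y - X) * E := by
      rw [transpose_mul, transpose_mul, transpose_transpose, (hY.sub hX).eq]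
      simp only [Matrix.mul_assoc]
    rw [h1, h2, h3, ← sub_eq_zero, ← neg_eq_zero.2 hRY, hF]
    simp only [Ric, transpose_add, transpose_sub, transpose_mul, transpose_transpose, hX.eq, hY.eq]
    noncomm_ring
  · convert hstab using 1
    rw [hF]
    simp only [Matrix.mul_assoc, Matrix.mul_add, Matrix.sub_mul, Matrix.mul_sub]
    abel

/-- A step of the Riccati iteration preserves the upper bound by a stabilizing solution. -/
theorem posSemidef_sub_of_step (hE : IsUnit E.det) (hX : X.IsSymm) (hY : Y.IsSymm) (hVs : V.IsSymm)
    (hXY : (Y - X).PosSemidef) (hRX : (Ric A E B₁ B₂ C X).PosSemidef)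
    (hRY : Ric A E B₁ B₂ C Y = 0)
    (hstab : IsStableMat (E⁻¹ * (A + (B₁ * B₁ᵀ - B₂ * B₂ᵀ) * Y * E)))
    (hV : (A + (B₁ * B₁ᵀ - B₂ * B₂ᵀ) * X * E)ᵀ * V * E
      + Eᵀ * V * (A + (B₁ * B₁ᵀ - B₂ * B₂ᵀ) * X * E)
      - Eᵀ * V * (B₂ * B₂ᵀ) * V * E + Ric A E B₁ B₂ C X = 0) :
    (Y - (X + V)).PosSemidef := by
  have hst := isStableMat_mixed_feedback hE hX hY hXY hRX hRY hstab
  set F := A + (B₁ * B₁ᵀ * X - B₂ * B₂ᵀ * Y) * E with hF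
  have hΔ : (Y - (X + V)).IsSymm := hY.sub (hX.add hVs)
  have hEu : IsUnit E := (isUnit_iff_isUnit_det E).2 hE
  rw [← hEu.posSemidef_star_left_conjugate_iff, star_eq_conjTranspose,
    conjTranspose_eq_transpose_of_trivial]
  refine posSemidef_of_lyapunov_real hst ?_ ?_
  · rw [IsSymm, transpose_mul, transpose_mul, transpose_transpose, hΔ.eq, mul_assoc]
  · have hsum := ((posSemidef_mul_transpose_self B₂).symm_conj hΔ E).add
      ((posSemidef_mul_transpose_self B₁).symm_conj (hY.sub hX) E)
    convert hsum using 1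
    have h1 : (E⁻¹ * F)ᵀ * (Eᵀ * (Y - (X + V)) * E) = Fᵀ * (Y - (X + V)) * E := by
      calc _ = (E * (E⁻¹ * F))ᵀ * (Y - (X + V)) * E := by
            rw [transpose_mul E]
            simp only [mul_assoc]
        _ = _ := by rw [mul_nonsing_inv_cancel_left _ _ hE]
    have h2 : Eᵀ * (Y - (X + V)) * E * (E⁻¹ * F) = Eᵀ * (Y - (X + V)) * F := by
      rw [mul_assoc _ E, mul_nonsing_inv_cancel_left _ _ hE]
    rw [h1, h2, ← sub_eq_zero, ← sub_eq_zero.2 (hV.trans hRY.symm), hF]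
    simp only [Ric, transpose_add, transpose_sub, transpose_mul, transpose_transpose, hX.eq, hY.eq]
    noncomm_ring

end

/-- The iterates of the Riccati iteration are bounded above by the stabilizing
solution in the Loewner order. -/
theorem riccati_iteration_bounded {n m₁ m₂ p : ℕ}
    (A E : Matrix (Fin n) (Fin n) ℝ) (hE : IsUnit E.det)
    (B₁ : Matrix (Fin n) (Fin m₁) ℝ) (B₂ : Matrix (Fin n) (Fin m₂) ℝ)
    (C : Matrix (Fin p) (Fin n) ℝ)
    (hstabilizable : ∃ K : Matrix (Fin m₂) (Fin n) ℝ, IsStableMat (E⁻¹ * (A - B₂ * K)))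
    (hdetect : ∀ (l : ℂ) (v : Fin n → ℂ), l.re = 0 →
      (l • E.map (algebraMap ℝ ℂ) - A.map (algebraMap ℝ ℂ)).mulVec v = 0 →
      (C.map (algebraMap ℝ ℂ)).mulVec v = 0 → v = 0)
    (Xinf : Matrix (Fin n) (Fin n) ℝ) (hXinfPSD : Xinf.PosSemidef)
    (hXinfSol : Ric A E B₁ B₂ C Xinf = 0)
    (hXinfStab : IsStableMat (E⁻¹ * (A + (B₁ * B₁ᵀ - B₂ * B₂ᵀ) * Xinf * E)))
    (X W : ℕ → Matrix (Fin n) (Fin n) ℝ)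
    (hiter : RiccatiIter A E B₁ B₂ C X W)
    (hstab : ∀ k : ℕ, IsStableMat (E⁻¹ * ((A + (B₁ * B₁ᵀ - B₂ * B₂ᵀ) * X k * E)
      - B₂ * B₂ᵀ * W (k + 1) * E))) :
    ∀ k : ℕ, (Xinf - X k).PosSemidef := by
  obtain ⟨hX0, hXs, hWs, hXW, hstep⟩ := hiter
  have hYs : Xinf.IsSymm := by simpa [IsHermitian, IsSymm] using hXinfPSD.1
  have key : ∀ k, (Xinf - X k).PosSemidef ∧ (Ric A E B₁ B₂ C (X k)).PosSemidef := by
    intro k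
    induction k with
    | zero =>
      rw [hX0]
      refine ⟨by simpa using hXinfPSD, ?_⟩
      simpa [Ric] using posSemidef_conjTranspose_mul_self C
    | succ k ih =>
      rw [hXW k]
      refine ⟨posSemidef_sub_of_step hE (hXs k) hYs (hWs k) ih.1 ih.2 hXinfSol hXinfStab
        (hstep k), ?_⟩
      rw [Ric_add_of_step (hstep k) (hXs k)]
      exact (posSemidef_mul_transpose_self B₁).symm_conj (hWs k) E
  exact fun k => (key k).1
end

section
/- Let (X_k)_{k≥0}, (W_k)_{k≥1} be a Riccati iteration sequence in which every W_k is positive semidefinite, and suppose the sequence (X_k) converges to a matrix X* (entrywise). Then X* is symmetric positive semidefinite and solves the indefinite Riccati equation, R(X*) = 0. -/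
open Matrix

/-- A limit of real positive semidefinite matrices is positive semidefinite. -/
theorem Matrix.PosSemidef.of_tendsto {ι : Type*} [Fintype ι] {X : ℕ → Matrix ι ι ℝ}
    {L : Matrix ι ι ℝ} (hX : ∀ k, (X k).PosSemidef)
    (hL : Filter.Tendsto X Filter.atTop (nhds L)) : L.PosSemidef := by
  refine .of_dotProduct_mulVec_nonneg ?_ fun x => ?_
  · refine tendsto_nhds_unique ?_ hL
    have h := (Continuous.matrix_conjTranspose continuous_id).continuousAt.tendsto.comp hL
    exact h.congr fun k => (hX k).isHermitian
  · have hc : Continuous fun M : Matrix ι ι ℝ => star x ⬝ᵥ (M *ᵥ x) := by fun_prop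
    exact ge_of_tendsto' (hc.continuousAt.tendsto.comp hL)
      fun k => (hX k).dotProduct_mulVec_nonneg x

/-- If the updates of a Riccati iteration are positive semidefinite and the iterates
converge, then the limit is a symmetric positive semidefinite solution of the
indefinite Riccati equation. -/
theorem riccati_iteration_limit_solves {n m₁ m₂ p : ℕ}
    (A E : Matrix (Fin n) (Fin n) ℝ) (hE : IsUnit E.det)
    (B₁ : Matrix (Fin n) (Fin m₁) ℝ) (B₂ : Matrix (Fin n) (Fin m₂) ℝ)
    (C : Matrix (Fin p) (Fin n) ℝ)
    (X W : ℕ → Matrix (Fin n) (Fin n) ℝ)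
    (hiter : RiccatiIter A E B₁ B₂ C X W)
    (hWpsd : ∀ k : ℕ, (W (k + 1)).PosSemidef)
    (Xstar : Matrix (Fin n) (Fin n) ℝ)
    (hconv : Filter.Tendsto X Filter.atTop (nhds Xstar)) :
    Xstar.PosSemidef ∧ Ric A E B₁ B₂ C Xstar = 0 := by
  obtain ⟨hX0, -, -, hstep, heq⟩ := hiter
  have hXpsd : ∀ k, (X k).PosSemidef := by
    intro k
    induction k with
    | zero => rw [hX0]; exact .zero
    | succ k ih => rw [hstep]; exact ih.add (hWpsd k)
  refine ⟨.of_tendsto hXpsd hconv, ?_⟩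
  have hW : Filter.Tendsto (fun k => W (k + 1)) Filter.atTop (nhds 0) := by
    have h := ((Filter.tendsto_add_atTop_iff_nat 1).2 hconv).sub hconv
    rw [sub_self] at h
    exact h.congr fun k => by rw [hstep, add_sub_cancel_left]
  let F : Matrix (Fin n) (Fin n) ℝ × Matrix (Fin n) (Fin n) ℝ → Matrix (Fin n) (Fin n) ℝ :=
    fun P => (A + (B₁ * B₁ᵀ - B₂ * B₂ᵀ) * P.1 * E)ᵀ * P.2 * E
      + Eᵀ * P.2 * (A + (B₁ * B₁ᵀ - B₂ * B₂ᵀ) * P.1 * E)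
      - Eᵀ * P.2 * (B₂ * B₂ᵀ) * P.2 * E
      + Ric A E B₁ B₂ C P.1
  have hF : Continuous F := by
    unfold F Ric
    fun_prop
  have hlim : Filter.Tendsto (fun k => F (X k, W (k + 1))) Filter.atTop
      (nhds (F (Xstar, 0))) :=
    (hF.tendsto _).comp (hconv.prodMk_nhds hW)
  have hzero : F (Xstar, 0) = 0 :=
    tendsto_nhds_unique hlim (tendsto_const_nhds.congr fun k => (heq k).symm)
  simpa [F] using hzero
end

section
/- Let Ẽ ∈ ℝ^{ñ×ñ} be symmetric and invertible, J ∈ ℝ^{ñ_p×ñ} with JẼ⁻¹Jᵀ invertible, Π := I_ñ − Ẽ⁻¹Jᵀ(JẼ⁻¹Jᵀ)⁻¹J, Ã_k ∈ ℝ^{ñ×ñ}, σ ∈ ℝ, and F ∈ ℝ^{ñ×ℓ} with ΠᵀF = F. If X ∈ ℝ^{ñ×ℓ} and X⊥ ∈ ℝ^{ñ_p×ℓ} solve the saddle-point system (σẼᵀ − Ã_kᵀ)X − JᵀX⊥ = F and −JX = 0, then X satisfies the constraint-compatibility condition ΠX = X and solves the projected shifted system (σẼᵀ − ΠᵀÃ_kᵀΠ)X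 = F. -/
open Matrix

/-- The discrete Leray projection maps into the kernel of the constraint matrix. -/
theorem constraint_mul_leray {m n : Type*} [Fintype m] [DecidableEq m] [Fintype n] [DecidableEq n]
    {E : Matrix n n ℝ} {J : Matrix m n ℝ} (hJ : IsUnit (J * E⁻¹ * Jᵀ).det) :
    J * (1 - E⁻¹ * Jᵀ * (J * E⁻¹ * Jᵀ)⁻¹ * J) = 0 := by
  have h : J * (E⁻¹ * Jᵀ * (J * E⁻¹ * Jᵀ)⁻¹ * J) =
      J * E⁻¹ * Jᵀ * (J * E⁻¹ * Jᵀ)⁻¹ * J := by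
    simp only [Matrix.mul_assoc]
  rw [Matrix.mul_sub, Matrix.mul_one, h, Matrix.mul_nonsing_inv _ hJ, Matrix.one_mul, sub_self]

/-- The discrete Leray projection is self-adjoint with respect to the mass matrix. -/
theorem leray_transpose_mul {m n : Type*} [Fintype m] [DecidableEq m] [Fintype n] [DecidableEq n]
    {E : Matrix n n ℝ} (hsymm : E.IsSymm) (hE : IsUnit E.det) (J : Matrix m n ℝ) :
    (1 - E⁻¹ * Jᵀ * (J * E⁻¹ * Jᵀ)⁻¹ * J)ᵀ * E = E * (1 - E⁻¹ * Jᵀ * (J * E⁻¹ * Jᵀ)⁻¹ * J) := by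
  simp only [Matrix.transpose_sub, Matrix.transpose_one, Matrix.transpose_mul,
    Matrix.transpose_transpose, Matrix.transpose_nonsing_inv, hsymm.eq, Matrix.sub_mul,
    Matrix.mul_sub, Matrix.one_mul, Matrix.mul_one, Matrix.mul_assoc,
    Matrix.nonsing_inv_mul _ hE, Matrix.mul_nonsing_inv_cancel_left _ _ hE]

/-- A solution of the saddle-point system satisfies the constraint-compatibility
condition and solves the projected shifted system. -/
theorem saddle_point_projected_solve {nt np ℓ : ℕ}
    (Etl : Matrix (Fin nt) (Fin nt) ℝ) (hEtlsymm : Etl.IsSymm) (hEtl : IsUnit Etl.det)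
    (J : Matrix (Fin np) (Fin nt) ℝ) (hJ : IsUnit (J * Etl⁻¹ * Jᵀ).det)
    (Atlk : Matrix (Fin nt) (Fin nt) ℝ) (σ : ℝ)
    (F : Matrix (Fin nt) (Fin ℓ) ℝ)
    (hF : ((1 : Matrix (Fin nt) (Fin nt) ℝ) - Etl⁻¹ * Jᵀ * (J * Etl⁻¹ * Jᵀ)⁻¹ * J)ᵀ * F = F)
    (X : Matrix (Fin nt) (Fin ℓ) ℝ) (Xp : Matrix (Fin np) (Fin ℓ) ℝ)
    (hsys₁ : (σ • Etlᵀ - Atlkᵀ) * X - Jᵀ * Xp = F)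
    (hsys₂ : -(J * X) = 0) :
    ((1 : Matrix (Fin nt) (Fin nt) ℝ) - Etl⁻¹ * Jᵀ * (J * Etl⁻¹ * Jᵀ)⁻¹ * J) * X = X ∧
    (σ • Etlᵀ -
      ((1 : Matrix (Fin nt) (Fin nt) ℝ) - Etl⁻¹ * Jᵀ * (J * Etl⁻¹ * Jᵀ)⁻¹ * J)ᵀ * Atlkᵀ *
      ((1 : Matrix (Fin nt) (Fin nt) ℝ) - Etl⁻¹ * Jᵀ * (J * Etl⁻¹ * Jᵀ)⁻¹ * J)) * X = F := by
  have hPX : (1 - Etl⁻¹ * Jᵀ * (J * Etl⁻¹ * Jᵀ)⁻¹ * J) * X = X := by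
    rw [Matrix.sub_mul, Matrix.one_mul, Matrix.mul_assoc _ J X, neg_eq_zero.mp hsys₂,
      Matrix.mul_zero, sub_zero]
  have hJP := constraint_mul_leray hJ
  have hPE := leray_transpose_mul hEtlsymm hEtl J
  refine ⟨hPX, ?_⟩
  generalize 1 - Etl⁻¹ * Jᵀ * (J * Etl⁻¹ * Jᵀ)⁻¹ * J = P at *
  have hPJ : Pᵀ * Jᵀ = 0 := by rw [← Matrix.transpose_mul, hJP, Matrix.transpose_zero]
  have hPEX : Pᵀ * (Etl * X) = Etl * X := by
    rw [← Matrix.mul_assoc, hPE, Matrix.mul_assoc, hPX]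
  calc (σ • Etlᵀ - Pᵀ * Atlkᵀ * P) * X = σ • (Etl * X) - Pᵀ * (Atlkᵀ * X) := by
        rw [Matrix.sub_mul, Matrix.mul_assoc _ P X, hPX, Matrix.smul_mul, hEtlsymm.eq,
          Matrix.mul_assoc]
    _ = Pᵀ * ((σ • Etlᵀ - Atlkᵀ) * X - Jᵀ * Xp) := by
        rw [Matrix.mul_sub, ← Matrix.mul_assoc Pᵀ Jᵀ Xp, hPJ, Matrix.zero_mul, sub_zero,
          Matrix.sub_mul, Matrix.mul_sub, Matrix.smul_mul, Matrix.mul_smul, hEtlsymm.eq, hPEX]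
    _ = F := by rw [hsys₁, hF]
end
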